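/- Claim 4 of Proposition A.1: Let x_1, ..., x_l in R^k (l <= k) be linearly independent, let c be a nonzero vector in span(x_1, ..., x_l), set M = (1/l) * sum_{i=1}^l x_i x_i^T, fix d with M d = c, and define eps_i* = sign(x_i^T d), p_i* = |x_i^T d| / sum_j |x_j^T d|, the design xi* = {(x_i, p_i*)}, and z* = sum_i eps_i* p_i* x_i. Then Psi(xi*) = ||c||^2 / ||z*||^2, where ||.|| is the Euclidean norm. -/

import Mathlib

open Matrix BigOperators

/-- The information matrix of a design with points `x i` and weights `p i`. -/
noncomputable def infoMat {k l : ℕ} (x : Fin l → Fin k → ℝ) (p : Fin l → ℝ) :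
    Matrix (Fin k) (Fin k) ℝ :=
  ∑ i, p i • vecMulVec (x i) (x i)

/-- The optimal sign `ε_i* = sign(x_iᵀ d)`, where `d` solves `M d = c`. -/
noncomputable def epsStar {k l : ℕ} (x : Fin l → Fin k → ℝ) (d : Fin k → ℝ) (i : Fin l) : ℝ :=
  Real.sign (x i ⬝ᵥ d)

/-- The optimal weight `p_i* = |x_iᵀ d| / ∑ j |x_jᵀ d|`, where `d` solves `M d = c`. -/
noncomputable def pStar {k l : ℕ} (x : Fin l → Fin k → ℝ) (d : Fin k → ℝ) (i : Fin l) : ℝ :=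
  |x i ⬝ᵥ d| / ∑ j, |x j ⬝ᵥ d|

/-- The Elfving point `z* = ∑ i ε_i* p_i* x_i`. -/
noncomputable def zStar {k l : ℕ} (x : Fin l → Fin k → ℝ) (d : Fin k → ℝ) : Fin k → ℝ :=
  ∑ i, (epsStar x d i * pStar x d i) • x i

lemma sum_smul_vecMulVec_mulVec {ι n : Type*} [Fintype n] (s : Finset ι) (x : ι → n → ℝ)
    (p : ι → ℝ) (v : n → ℝ) :
    (∑ i ∈ s, p i • vecMulVec (x i) (x i)) *ᵥ v = ∑ i ∈ s, (p i * (x i ⬝ᵥ v)) • x i := by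
  rw [sum_mulVec]
  refine Finset.sum_congr rfl fun i _ => ?_
  rw [smul_mulVec, vecMulVec_mulVec, op_smul_eq_smul, smul_smul]

lemma Real.sign_mul_abs_self (r : ℝ) : Real.sign r * |r| = r := by
  rcases lt_trichotomy r 0 with h | rfl | h
  · rw [Real.sign_of_neg h, abs_of_neg h]; ring
  · simp
  · rw [Real.sign_of_pos h, abs_of_pos h]; ring

lemma zStar_eq {k l : ℕ} (x : Fin l → Fin k → ℝ) (d : Fin k → ℝ) :
    zStar x d = (∑ j, |x j ⬝ᵥ d|)⁻¹ • ∑ i, (x i ⬝ᵥ d) • x i := by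
  rw [zStar, Finset.smul_sum]
  refine Finset.sum_congr rfl fun i _ => ?_
  rw [smul_smul, epsStar, pStar, ← mul_div_assoc, Real.sign_mul_abs_self, div_eq_inv_mul]

/-- Claim 4 of Proposition A.1: `Ψ(ξ*) = ‖c‖² / ‖z*‖²`, where the criterion
value `Ψ(ξ*)` is `cᵀ e` for any `e` with `M(ξ*) e = c`, and `‖v‖² = v ⬝ᵥ v` is the squared
Euclidean norm. -/
theorem Psi_xiStar_eq {k l : ℕ} (hk : 1 ≤ k) (hl : l ≤ k)
    (x : Fin l → Fin k → ℝ) (hxLI : LinearIndependent ℝ x)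
    (c : Fin k → ℝ) (hc : c ≠ 0) (hcspan : c ∈ Submodule.span ℝ (Set.range x))
    (M : Matrix (Fin k) (Fin k) ℝ) (hM : M = (l : ℝ)⁻¹ • ∑ i, vecMulVec (x i) (x i))
    (d : Fin k → ℝ) (hd : M *ᵥ d = c) :
    ∀ e : Fin k → ℝ, (infoMat x (pStar x d)) *ᵥ e = c →
      c ⬝ᵥ e = (c ⬝ᵥ c) / (zStar x d ⬝ᵥ zStar x d) := by
  intro e he
  set S : ℝ := ∑ j, |x j ⬝ᵥ d| with hS
  have hc' : c = (l : ℝ)⁻¹ • ∑ i, (x i ⬝ᵥ d) • x i := by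
    rw [← hd, hM, smul_mulVec]
    congr 1
    simpa using sum_smul_vecMulVec_mulVec Finset.univ x (fun _ => 1) d
  have hl0 : (l : ℝ) ≠ 0 := by
    intro h
    simp [hc', h] at hc
  have hS0 : S ≠ 0 := by
    intro h
    have hz := (Finset.sum_eq_zero_iff_of_nonneg fun j _ => abs_nonneg (x j ⬝ᵥ d)).1 h
    refine hc ?_
    rw [hc', Finset.sum_eq_zero, smul_zero]
    intro i hi
    rw [abs_eq_zero.1 (hz i hi), zero_smul]
  have hcoef (i : Fin l) : pStar x d i * (x i ⬝ᵥ e) = (l : ℝ)⁻¹ * (x i ⬝ᵥ d) := by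
    rw [infoMat, sum_smul_vecMulVec_mulVec, hc', Finset.smul_sum] at he
    simp only [smul_smul] at he
    exact congrFun (hxLI.fintypeLinearCombination_injective he) i
  have hprod (i : Fin l) : (x i ⬝ᵥ d) * (x i ⬝ᵥ e) = S / l * |x i ⬝ᵥ d| := by
    rcases eq_or_ne (x i ⬝ᵥ d) 0 with h | h
    · simp [h]
    · have hi := hcoef i
      rw [pStar, ← hS] at hi
      field_simp at hi
      field_simp
      refine mul_left_cancel₀ (abs_ne_zero.2 h) ?_
      linear_combination (x i ⬝ᵥ d) * hi - S * sq_abs (x i ⬝ᵥ d)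
  have hce : c ⬝ᵥ e = (S / l) ^ 2 := by
    rw [hc', smul_dotProduct, sum_dotProduct]
    simp only [smul_dotProduct, smul_eq_mul, hprod]
    rw [← Finset.mul_sum, ← hS]
    ring
  have hz : zStar x d = (l / S) • c := by
    rw [zStar_eq, ← hS, hc', smul_smul]
    congr 1
    field_simp
  have hcc : c ⬝ᵥ c ≠ 0 := fun h => hc (dotProduct_self_eq_zero.1 h)
  rw [hce, hz, smul_dotProduct, dotProduct_smul, smul_eq_mul, smul_eq_mul]
  field_simp
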